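/- Let K be the algebraic closure of F_13. There exist s, α ∈ K with s² = −2 and α² = 6s − 1 such that, setting P := y²z − (x³ + 5·x·z² + s·z³) and Q := w² − (x² + α·x·y + 6s·x·z + (8s+3)·y² + 3αs·y·z + (8s−6)·z²) in K[x,y,z,w], the projective curve C = V(P,Q) ⊂ ℙ³(K) is nonsingular and for all 1 ≤ i, j ≤ 4 the coefficient of x^{13·e_{i1}−e_{j1}}·y^{13·e_{i2}−e_{j2}}·z^{13·e_{i3}−e_{j3}}·w^{13·e_{i4}−e_{j4}} in (P·Q)^{12} is zero; that is, C is a superspecial genus-4 curve (a superspecial DCEC) in characteristic 13. -/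

import Mathlib

open MvPolynomial

noncomputable section

/-- The 2×4 Jacobian matrix of `(P, Q)` evaluated at a representative `v`. -/
def jacMat {K : Type*} [Field K] (P Q : MvPolynomial (Fin 4) K) (v : Fin 4 → K) :
    Matrix (Fin 2) (Fin 4) K :=
  Matrix.of fun i k => eval v (pderiv k (![P, Q] i))

/-- The exponent matrix `(e_{ij})` with rows `(1,1,1,2), (1,1,2,1), (1,2,0,1), (2,1,1,1)`. -/
def eMat : Fin 4 → Fin 4 → ℕ :=
  ![![1, 1, 1, 2], ![1, 1, 2, 1], ![1, 2, 0, 1], ![2, 1, 1, 1]]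

/-- The Hasse–Witt matrix of `C = V(P,Q)` vanishes (the guard handles the entries whose
exponent vector has a negative component, for which the coefficient is zero trivially). -/
def HasseWittVanishes {K : Type*} [Field K] (p : ℕ) (P Q : MvPolynomial (Fin 4) K) : Prop :=
  ∀ i j : Fin 4, (∀ k : Fin 4, eMat j k ≤ p * eMat i k) →
    MvPolynomial.coeff (Finsupp.equivFunOnFinite.symm fun k => p * eMat i k - eMat j k)
      ((P * Q) ^ (p - 1)) = 0

instance : Fact (Nat.Prime 13) := ⟨by norm_num⟩

/-- The algebraic closure of `F_13`. -/
abbrev K13 := AlgebraicClosure (ZMod 13)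

/-- `P = y²z − (x³ + 5xz² + s·z³)` over the algebraic closure of `F_13`. -/
def P13 (s : K13) : MvPolynomial (Fin 4) K13 :=
  X 1 ^ 2 * X 2 - (X 0 ^ 3 + C 5 * X 0 * X 2 ^ 2 + C s * X 2 ^ 3)

/-- `Q = w² − (x² + αxy + 6s·xz + (8s+3)y² + 3αs·yz + (8s−6)z²)` over the algebraic
closure of `F_13`. -/
def Q13 (s α : K13) : MvPolynomial (Fin 4) K13 :=
  X 3 ^ 2 - (X 0 ^ 2 + C α * X 0 * X 1 + C (6 * s) * X 0 * X 2 +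
    C (8 * s + 3) * X 1 ^ 2 + C (3 * α * s) * X 1 * X 2 + C (8 * s - 6) * X 2 ^ 2)


section ListPoly

variable {A : Type} (z : A) (ad mu : A → A → A)

/-- Addition of coefficient lists. -/
def addL : List A → List A → List A
  | [], m => m
  | a :: l, [] => a :: l
  | a :: l, b :: m => ad a b :: addL l m

/-- Multiplication of coefficient lists. -/
def mulL : List A → List A → List A
  | [], _ => []
  | [a], m => m.map (mu a)
  | a :: l, m => addL ad (m.map (mu a)) (z :: mulL l m)

/-- Power of a coefficient list. -/
def powL (one : A) (l : List A) : ℕ → List A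
  | 0 => [one]
  | n + 1 => mulL z ad mu l (powL one l n)

variable {R : Type*} [CommRing R] (i : A → R)

/-- The polynomial with given coefficient list. -/
def toP : List A → Polynomial R
  | [] => 0
  | a :: l => Polynomial.C (i a) + Polynomial.X * toP l

theorem toP_add (hadd : ∀ a b, i (ad a b) = i a + i b) :
    ∀ l m, toP i (addL ad l m) = toP i l + toP i m
  | [], m => by simp [addL, toP]
  | a :: l, [] => by simp [addL, toP]
  | a :: l, b :: m => by
      simp only [addL, toP, toP_add hadd l m, hadd, Polynomial.C_add]; ring

theorem toP_map (hmul : ∀ a b, i (mu a b) = i a * i b) (a : A) :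
    ∀ m, toP i (m.map (mu a)) = Polynomial.C (i a) * toP i m
  | [] => by simp [toP]
  | b :: m => by
      simp only [List.map, toP, toP_map hmul a m, hmul, Polynomial.C_mul]; ring

theorem toP_mul (hz : i z = 0) (hadd : ∀ a b, i (ad a b) = i a + i b)
    (hmul : ∀ a b, i (mu a b) = i a * i b) :
    ∀ l m, toP i (mulL z ad mu l m) = toP i l * toP i m
  | [], m => by simp [mulL, toP]
  | [a], m => by simp [mulL, toP, toP_map mu i hmul]
  | a :: b :: l, m => by
      have := toP_mul hz hadd hmul (b :: l) m
      rw [mulL, toP_add ad i hadd, toP_map mu i hmul, toP, this, hz]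
      · simp only [Polynomial.C_0, toP]; ring
      · simp

theorem toP_pow (one : A) (hz : i z = 0) (h1 : i one = 1)
    (hadd : ∀ a b, i (ad a b) = i a + i b)
    (hmul : ∀ a b, i (mu a b) = i a * i b) (l : List A) :
    ∀ n, toP i (powL z ad mu one l n) = toP i l ^ n
  | 0 => by simp [powL, toP, h1]
  | n + 1 => by
      rw [powL, toP_mul z ad mu i hz hadd hmul, toP_pow one hz h1 hadd hmul l n, pow_succ']

theorem toP_coeff (hz : i z = 0) : ∀ l n, (toP i l).coeff n = i (l.getD n z)
  | [], n => by simp [toP, hz]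
  | a :: l, 0 => by simp [toP]
  | a :: l, n + 1 => by
      simp [toP, toP_coeff hz l n]

end ListPoly

/-- Pairs `(a, b)` stand for `a + b s`. -/
def padd13 (a b : ℕ × ℕ) : ℕ × ℕ := ((a.1 + b.1) % 13, (a.2 + b.2) % 13)

/-- Product of pairs, with `s ^ 2 = 11`. -/
def pmul13 (a b : ℕ × ℕ) : ℕ × ℕ :=
  ((a.1 * b.1 + 11 * (a.2 * b.2)) % 13, (a.1 * b.2 + a.2 * b.1) % 13)

abbrev XL := List (ℕ × ℕ)
abbrev addX : XL → XL → XL := addL padd13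
abbrev mulX : XL → XL → XL := mulL (0, 0) padd13 pmul13
abbrev mulXY : List XL → List XL → List XL := mulL [] addX mulX
abbrev powXY : List XL → ℕ → List XL := powL [] addX mulX [(1, 0)]

def gX : XL := [(0, 1), (5, 0), (0, 0), (1, 0)]
def PX : List XL := [[(0, 12), (8, 0), (0, 0), (12, 0)], [], [(12, 6)]]
def fX : List XL := [[(7, 8), (0, 6), (1, 0)], mulX [(12, 6)] [(0, 3), (1, 0)],
  mulX [(12, 6)] [(3, 8)]]

def chk (r : List XL) (n : ℕ) : Bool := ((r.getD 12 []).getD n (0, 0)) == (0, 0)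

def chkAll (r : List XL) : Bool := chk r 11 && chk r 12 && chk r 24 && chk r 25

theorem chk1 : chk (powXY PX 12) 12 = true := by decide +kernel

theorem chk2 : chkAll (mulXY (powXY fX 6) (powXY PX 12)) = true := by decide +kernel

theorem h13 : (13 : K13) = 0 := by
  have : ((13 : ℕ) : K13) = 0 := CharP.cast_eq_zero K13 13
  exact_mod_cast this

theorem cast_mod13 (n : ℕ) : ((n % 13 : ℕ) : K13) = n := by
  conv_rhs => rw [← Nat.mod_add_div n 13]
  push_cast
  linear_combination (-(n / 13 : ℕ) : K13) * h13

/-- Interpretation of a pair. -/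
def iP (s : K13) (a : ℕ × ℕ) : K13 := a.1 + a.2 * s

theorem iP_add (s : K13) (a b) : iP s (padd13 a b) = iP s a + iP s b := by
  simp only [iP, padd13, cast_mod13]; push_cast; ring

theorem iP_mul (s : K13) (hs : s ^ 2 = -2) (a b) : iP s (pmul13 a b) = iP s a * iP s b := by
  simp only [iP, pmul13, cast_mod13]; push_cast
  linear_combination (a.2 * b.2 : K13) * (h13 - hs)

theorem iP_zero (s : K13) : iP s (0, 0) = 0 := by simp [iP]

theorem iP_one (s : K13) : iP s (1, 0) = 1 := by simp [iP]

theorem X_add (s : K13) (l m) : toP (iP s) (addX l m) = toP (iP s) l + toP (iP s) m :=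
  toP_add _ _ (iP_add s) l m

theorem X_mul (s : K13) (hs : s ^ 2 = -2) (l m) :
    toP (iP s) (mulX l m) = toP (iP s) l * toP (iP s) m :=
  toP_mul _ _ _ _ (iP_zero s) (iP_add s) (iP_mul s hs) l m

/-- Interpretation of a two-variable list. -/
abbrev iXY (s : K13) : List XL → Polynomial (Polynomial K13) := toP (toP (iP s))

theorem XY_mul (s : K13) (hs : s ^ 2 = -2) (l m) :
    iXY s (mulXY l m) = iXY s l * iXY s m :=
  toP_mul [] addX mulX (toP (iP s)) rfl (X_add s) (X_mul s hs) l m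

theorem XY_pow (s : K13) (hs : s ^ 2 = -2) (l n) :
    iXY s (powXY l n) = iXY s l ^ n :=
  toP_pow [] addX mulX (toP (iP s)) _ rfl (by simp [toP, iP_one]) (X_add s) (X_mul s hs) l n

theorem XY_coeff (s : K13) (l a) (h : chk l a = true) : ((iXY s l).coeff 12).coeff a = 0 := by
  rw [iXY, toP_coeff [] _ rfl, toP_coeff (0, 0) _ (iP_zero s)]
  simp only [chk, beq_iff_eq] at h
  rw [h, iP_zero]

/-- Dehomogenization, with `y` scaled by `α`. -/
def psi (α : K13) : MvPolynomial (Fin 4) K13 →ₐ[K13]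
    Polynomial (Polynomial (Polynomial K13)) :=
  aeval (R := K13) (S₁ := Polynomial (Polynomial (Polynomial K13)))
    ![Polynomial.C (Polynomial.C Polynomial.X),
      Polynomial.C (Polynomial.C (Polynomial.C α) * Polynomial.X), 1, Polynomial.X]

theorem psi_monomial (α : K13) (m : Fin 4 →₀ ℕ) (c : K13) :
    psi α (monomial m c) =
      Polynomial.monomial (m 3) (Polynomial.monomial (m 1)
        (Polynomial.monomial (m 0) (α ^ (m 1) * c))) := by
  rw [psi, aeval_monomial, Finsupp.prod_fintype _ _ (by simp)]
  simp only [Fin.prod_univ_four, ← Polynomial.C_mul_X_pow_eq_monomial]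
  simp [Polynomial.algebraMap_apply]
  ring

theorem psi_coeff (α : K13) (F : MvPolynomial (Fin 4) K13) {n : ℕ} (hF : F.IsHomogeneous n)
    (m : Fin 4 →₀ ℕ) (hm : m 0 + m 1 + m 2 + m 3 = n) :
    (((psi α F).coeff (m 3)).coeff (m 1)).coeff (m 0) = α ^ (m 1) * coeff m F := by
  conv_lhs => rw [F.as_sum]
  conv_rhs => rw [F.as_sum]
  simp only [map_sum, Polynomial.finsetSum_coeff, coeff_sum, Finset.mul_sum]
  refine Finset.sum_congr rfl fun d hd => ?_
  have hd' : d 0 + d 1 + d 2 + d 3 = n := by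
    have := hF (mem_support_iff.mp hd)
    rw [Finsupp.weight_apply, Finsupp.sum_fintype _ _ (by simp)] at this
    simpa [Fin.sum_univ_four] using this
  rw [psi_monomial, coeff_monomial]
  by_cases h : d = m
  · subst h; simp
  · rw [if_neg h, mul_zero]
    simp only [Polynomial.coeff_monomial]
    by_cases h3 : d 3 = m 3
    · by_cases h1 : d 1 = m 1
      · by_cases h0 : d 0 = m 0
        · exfalso; apply h
          ext k
          fin_cases k <;> simp <;> omega
        · simp [h3, h1, h0, Polynomial.coeff_monomial]
      · simp [h3, h1, Polynomial.coeff_monomial]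
    · simp [h3]

theorem P_hom (s : K13) : (P13 s).IsHomogeneous 3 := by
  unfold P13
  refine IsHomogeneous.sub ?_ (IsHomogeneous.add (IsHomogeneous.add ?_ ?_) ?_)
  · exact ((isHomogeneous_X _ _).pow 2).mul (isHomogeneous_X _ _)
  · exact (isHomogeneous_X _ _).pow 3
  · simpa using ((isHomogeneous_C _ _).mul (isHomogeneous_X _ _)).mul
      ((isHomogeneous_X _ _).pow 2)
  · simpa using (isHomogeneous_C _ _).mul ((isHomogeneous_X _ _).pow 3)

theorem Q_hom (s α : K13) : (Q13 s α).IsHomogeneous 2 := by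
  have h1 (c : K13) (i j : Fin 4) : (C c * X i * X j).IsHomogeneous 2 := by
    simpa using ((isHomogeneous_C _ c).mul (isHomogeneous_X _ i)).mul (isHomogeneous_X _ j)
  have h2 (c : K13) (i : Fin 4) : (C c * X i ^ 2).IsHomogeneous 2 := by
    simpa using (isHomogeneous_C _ c).mul ((isHomogeneous_X _ i).pow 2)
  have h3 (i : Fin 4) : ((X i : MvPolynomial (Fin 4) K13) ^ 2).IsHomogeneous 2 := by
    simpa using (isHomogeneous_X K13 i).pow 2
  unfold Q13
  exact (h3 3).sub ((((((h3 0).add (h1 _ _ _)).add (h1 _ _ _)).add (h2 _ _)).add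
    (h1 _ _ _)).add (h2 _ _))

theorem psi_P (s α : K13) (hα : α ^ 2 = 6 * s - 1) :
    psi α (P13 s) = Polynomial.C (iXY s PX) := by
  have e1 : iP s (12, 6) = α ^ 2 := by
    simp only [iP]; push_cast; linear_combination h13 - hα
  have e2 : iP s (0, 12) = - s := by simp only [iP]; push_cast; linear_combination s * h13
  have e3 : iP s (8, 0) = - 5 := by simp only [iP]; push_cast; linear_combination h13
  have e4 : iP s (12, 0) = - 1 := by simp only [iP]; push_cast; linear_combination h13
  simp only [PX, iXY, toP, e1, e2, e3, e4, iP_zero]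
  simp [psi, P13, Polynomial.algebraMap_apply]
  ring

theorem psi_Q (s α : K13) (hs : s ^ 2 = -2) (hα : α ^ 2 = 6 * s - 1) :
    psi α (Q13 s α) = Polynomial.X ^ 2 - Polynomial.C (iXY s fX) := by
  have e1 : iP s (12, 6) = α ^ 2 := by
    simp only [iP]; push_cast; linear_combination h13 - hα
  have e2 : iP s (3, 8) = 8 * s + 3 := by simp only [iP]; push_cast; ring
  have e3 : iP s (7, 8) = 8 * s - 6 := by simp only [iP]; push_cast; linear_combination h13
  have e4 : iP s (0, 6) = 6 * s := by simp only [iP]; push_cast; ring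
  have e5 : iP s (0, 3) = 3 * s := by simp only [iP]; push_cast; ring
  simp only [fX, iXY, toP, X_mul s hs, e1, e2, e3, e4, e5, iP_one]
  simp [psi, Q13, Polynomial.algebraMap_apply]
  ring

theorem gen_coeff {S : Type*} [CommRing S] (p f : S) (n : ℕ) :
    ((Polynomial.C p * (Polynomial.X ^ 2 - Polynomial.C f)) ^ 12).coeff n =
      if 2 ∣ n then p ^ 12 * ((-f) ^ (12 - n / 2) * (Nat.choose 12 (n / 2) : ℕ))
      else 0 := by
  have : (Polynomial.C p * (Polynomial.X ^ 2 - Polynomial.C f)) ^ 12 = Polynomial.C (p ^ 12) *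
      Polynomial.expand _ 2 ((Polynomial.X - Polynomial.C f) ^ 12) := by
    rw [mul_pow, map_pow, map_pow, map_sub, Polynomial.expand_X, Polynomial.expand_C]
  rw [this, Polynomial.coeff_C_mul, Polynomial.coeff_expand (by norm_num),
    sub_eq_add_neg, ← Polynomial.C_neg, Polynomial.coeff_X_add_C_pow]
  split_ifs <;> simp

theorem HW_coeff (s α : K13) (hs : s ^ 2 = -2) (hα : α ^ 2 = 6 * s - 1) (n : ℕ) :
    (psi α ((P13 s * Q13 s α) ^ 12)).coeff n =
      if 2 ∣ n then iXY s PX ^ 12 * ((-iXY s fX) ^ (12 - n / 2) * (Nat.choose 12 (n / 2) : ℕ))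
      else 0 := by
  rw [map_pow, map_mul, psi_P s α hα, psi_Q s α hs hα]
  exact gen_coeff _ _ n

theorem HW (s α : K13) (hs : s ^ 2 = -2) (hα : α ^ 2 = 6 * s - 1) :
    HasseWittVanishes 13 (P13 s) (Q13 s α) := by
  have hα0 : α ≠ 0 := by
    rintro rfl
    have : (8 : K13) = 0 := by linear_combination 36 * hs + (6 * s + 1) * hα - 5 * h13
    have h1 : (1 : K13) = 0 := by linear_combination 5 * this - 3 * h13
    exact one_ne_zero h1
  have hF : ((P13 s * Q13 s α) ^ 12).IsHomogeneous 60 :=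
    ((P_hom s).mul (Q_hom s α)).pow 12
  have key : ∀ m : Fin 4 →₀ ℕ, m 0 + m 1 + m 2 + m 3 = 60 →
      (((psi α ((P13 s * Q13 s α) ^ 12)).coeff (m 3)).coeff (m 1)).coeff (m 0) = 0 →
      coeff m ((P13 s * Q13 s α) ^ 12) = 0 := by
    intro m hm h
    rw [psi_coeff α _ hF m hm] at h
    exact (mul_eq_zero.mp h).resolve_left (pow_ne_zero _ hα0)
  have deg : ∀ m : Fin 4 →₀ ℕ, m 0 + m 1 + m 2 + m 3 ≠ 60 →
      coeff m ((P13 s * Q13 s α) ^ 12) = 0 := by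
    intro m hm
    apply hF.coeff_eq_zero
    rw [Finsupp.degree_eq_sum]
    simpa [Fin.sum_univ_four] using hm
  have c24 : (((psi α ((P13 s * Q13 s α) ^ 12)).coeff 24).coeff 12).coeff 12 = 0 := by
    have h : ((iXY s PX ^ 12).coeff 12).coeff 12 = 0 := by
      rw [← XY_pow s hs]; exact XY_coeff s _ _ chk1
    rw [HW_coeff s α hs hα]
    simpa using h
  have c12' : ∀ a, chk (mulXY (powXY fX 6) (powXY PX 12)) a = true →
      (((psi α ((P13 s * Q13 s α) ^ 12)).coeff 12).coeff 12).coeff a = 0 := by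
    intro a ha
    have := XY_coeff s _ _ ha
    rw [XY_mul s hs, XY_pow s hs, XY_pow s hs] at this
    have e : iXY s PX ^ 12 * ((-iXY s fX) ^ 6 * (Nat.choose 12 6 : ℕ)) =
      (Nat.choose 12 6 : ℕ) * (iXY s fX ^ 6 * iXY s PX ^ 12) := by ring
    rw [HW_coeff s α hs hα, if_pos (by norm_num), show 12 / 2 = 6 from rfl,
      show 12 - 6 = 6 from rfl, e, Polynomial.coeff_natCast_mul, Polynomial.coeff_natCast_mul,
      this, mul_zero]
  have hc := chk2
  simp only [chkAll, Bool.and_eq_true] at hc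
  obtain ⟨⟨⟨h11, h12⟩, h24⟩, h25⟩ := hc
  replace h11 := c12' _ h11
  replace h12 := c12' _ h12
  replace h24 := c12' _ h24
  replace h25 := c12' _ h25
  clear c12'
  have odd : ∀ n a b, ¬ 2 ∣ n →
      (((psi α ((P13 s * Q13 s α) ^ 12)).coeff n).coeff b).coeff a = 0 := by
    intro n a b hn
    rw [HW_coeff s α hs hα, if_neg hn]; simp
  generalize hG : (P13 s * Q13 s α) ^ 12 = G at *
  intro i j _
  change coeff _ ((P13 s * Q13 s α) ^ 12) = 0
  rw [hG]
  generalize hm : (Finsupp.equivFunOnFinite.symm fun k => 13 * eMat i k - eMat j k) = m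
  have hk : ∀ k, m k = 13 * eMat i k - eMat j k := by intro k; rw [← hm]; rfl
  have k0 := hk 0
  have k1 := hk 1
  have k2 := hk 2
  have k3 := hk 3
  clear hm hk
  fin_cases i <;> fin_cases j <;> simp [eMat] at k0 k1 k2 k3 <;>
    first
    | (apply deg; rw [k0, k1, k2, k3]; norm_num; done)
    | (apply key
       · rw [k0, k1, k2, k3]
       · rw [k0, k1, k3]
         first
         | exact c24
         | exact h11
         | exact h12
         | exact h24
         | exact h25
         | (apply odd; norm_num))

def RX : XL := addX (mulX [(4, 11), (2, 7), (1, 0), (3, 8)] [(4, 11), (2, 7), (1, 0), (3, 8)])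
  (mulX [(1, 7)] (mulX (mulX [(0, 3), (1, 0)] [(0, 3), (1, 0)]) gX))
def RdX : XL :=
  addX (mulX [(2, 0)] (mulX [(4, 11), (2, 7), (1, 0), (3, 8)] [(2, 7), (2, 0), (9, 24)]))
    (mulX [(1, 7)] (addX (mulX [(2, 0)] (mulX [(0, 3), (1, 0)] gX))
      (mulX (mulX [(0, 3), (1, 0)] [(0, 3), (1, 0)]) [(5, 0), (0, 0), (3, 0)])))
def UX : XL := [(10, 7), (10, 12), (8, 3), (10, 2), (4, 6)]
def VX : XL := [(2, 11), (8, 8), (10, 9), (3, 10), (6, 1), (8, 12)]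

theorem bez_list : addX (mulX UX RX) (mulX VX RdX) = (1, 0) :: List.replicate 10 (0, 0) := by
  decide +kernel

theorem bez (s t : K13) (hs : s ^ 2 = -2) (h g : K13)
    (hh : h = (8 * s + 3) * g + t ^ 2 + 6 * s * t + (8 * s - 6))
    (hg : g = t ^ 3 + 5 * t + s)
    (hR : h ^ 2 - (6 * s - 1) * (t + 3 * s) ^ 2 * g = 0)
    (hR' : 2 * h * ((8 * s + 3) * (3 * t ^ 2 + 5) + 2 * t + 6 * s) -
      2 * (6 * s - 1) * (t + 3 * s) * g - (6 * s - 1) * (t + 3 * s) ^ 2 * (3 * t ^ 2 + 5) = 0) :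
    False := by
  have e := congrArg (fun l => (toP (iP s) l).eval t) bez_list
  simp only [X_add, X_mul s hs, Polynomial.eval_add, Polynomial.eval_mul] at e
  have eh : (toP (iP s) [(4, 11), (2, 7), (1, 0), (3, 8)]).eval t = h := by
    simp only [toP, iP, Polynomial.eval_add, Polynomial.eval_mul, Polynomial.eval_C,
      Polynomial.eval_X, Polynomial.eval_zero]
    push_cast
    rw [hh, hg]
    linear_combination (-8 : K13) * hs + (2 - 3 * t * s - t) * h13
  have eg : (toP (iP s) gX).eval t = g := by
    simp only [gX, toP, iP, Polynomial.eval_add, Polynomial.eval_mul, Polynomial.eval_C,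
      Polynomial.eval_X, Polynomial.eval_zero]
    push_cast
    rw [hg]; ring
  have ea : (toP (iP s) [(1, 7)]).eval t = - (6 * s - 1) := by
    simp only [toP, iP, Polynomial.eval_add, Polynomial.eval_mul, Polynomial.eval_C,
      Polynomial.eval_X, Polynomial.eval_zero]
    push_cast
    linear_combination s * h13
  have el : (toP (iP s) [(0, 3), (1, 0)]).eval t = t + 3 * s := by
    simp only [toP, iP, Polynomial.eval_add, Polynomial.eval_mul, Polynomial.eval_C,
      Polynomial.eval_X, Polynomial.eval_zero]
    push_cast
    ring
  have e2 : (toP (iP s) [(2, 0)]).eval t = 2 := by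
    simp [toP, iP]
  have ehd : (toP (iP s) [(2, 7), (2, 0), (9, 24)]).eval t =
      (8 * s + 3) * (3 * t ^ 2 + 5) + 2 * t + 6 * s := by
    simp only [toP, iP, Polynomial.eval_add, Polynomial.eval_mul, Polynomial.eval_C,
      Polynomial.eval_X, Polynomial.eval_zero]
    push_cast
    linear_combination (-1 - 3 * s) * h13
  have egd : (toP (iP s) [(5, 0), (0, 0), (3, 0)]).eval t = 3 * t ^ 2 + 5 := by
    simp only [toP, iP, Polynomial.eval_add, Polynomial.eval_mul, Polynomial.eval_C,
      Polynomial.eval_X, Polynomial.eval_zero]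
    push_cast
    ring
  have eR : (toP (iP s) RX).eval t = 0 := by
    simp only [RX, X_add, X_mul s hs, Polynomial.eval_add, Polynomial.eval_mul, eh, eg, ea, el]
    linear_combination hR
  have eR' : (toP (iP s) RdX).eval t = 0 := by
    simp only [RdX, X_add, X_mul s hs, Polynomial.eval_add, Polynomial.eval_mul, eh, eg, ea, el,
      e2, ehd, egd]
    linear_combination hR'
  rw [eR, eR'] at e
  simp [toP, iP, List.replicate] at e

theorem nonsing (s α : K13) (hs : s ^ 2 = -2) (hα : α ^ 2 = 6 * s - 1) (v : Fin 4 → K13)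
    (hv : v ≠ 0) (hP : eval v (P13 s) = 0) (hQ : eval v (Q13 s α) = 0) :
    ¬ (jacMat (P13 s) (Q13 s α) v).rank ≤ 1 := by
  intro hr
  have hli : ¬ LinearIndependent K13 (jacMat (P13 s) (Q13 s α) v).row := by
    intro h
    have := h.rank_matrix
    simp at this
    omega
  have hli2 : ¬ LinearIndependent K13 ![(jacMat (P13 s) (Q13 s α) v).row 0,
      (jacMat (P13 s) (Q13 s α) v).row 1] := by
    intro h; apply hli
    convert h using 1
    ext i k; fin_cases i <;> rfl
  rw [LinearIndependent.pair_iff] at hli2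
  push Not at hli2
  obtain ⟨a, b, hab, hne⟩ := hli2
  have r0 := congrFun hab 0
  have r1 := congrFun hab 1
  have r2 := congrFun hab 2
  have r3 := congrFun hab 3
  simp [jacMat, P13, Q13, pderiv_X, Matrix.row] at r0 r1 r2 r3
  simp [P13] at hP
  simp [Q13] at hQ
  have two : (2 : K13) ≠ 0 := by
    intro h
    exact one_ne_zero (α := K13) (by linear_combination h13 - 6 * h)
  have hc2 : (8 * s + 3 : K13) ≠ 0 := by
    intro h
    exact one_ne_zero (α := K13)
      (by linear_combination 2 * (3 - 8 * s) * h + 128 * hs - 21 * h13)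
  replace r3 : b = 0 ∨ v 3 = 0 := by tauto
  have hv' : ¬ (v 0 = 0 ∧ v 1 = 0 ∧ v 2 = 0 ∧ v 3 = 0) := by
    rintro ⟨h0, h1, h2, h3⟩
    apply hv; ext k; fin_cases k <;> assumption
  generalize v 0 = x at *
  generalize v 1 = y at *
  generalize v 2 = z at *
  generalize v 3 = w at *
  by_cases hz : z = 0
  · subst hz
    have hx : x = 0 := by
      have : x ^ 3 = 0 := by linear_combination -hP
      exact pow_eq_zero_iff (by norm_num) |>.mp this
    subst hx
    have hy : y = 0 := by
      rcases r3 with hb | hw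
      · have ha : a ≠ 0 := fun h => hne h hb
        have : a * y ^ 2 = 0 := by rw [hb] at r2; linear_combination r2
        simpa [ha] using this
      · have : (8 * s + 3) * y ^ 2 = 0 := by rw [hw] at hQ; linear_combination -hQ
        simpa [hc2] using this
    subst hy
    have hw : w ^ 2 = 0 := by linear_combination hQ
    exact hv' ⟨rfl, rfl, rfl, by simpa using hw⟩
  by_cases hb : b = 0
  · have ha : a ≠ 0 := fun h => hne h hb
    subst hb
    have hy : y = 0 := by
      have : a * (z * (2 * y)) = 0 := by linear_combination r1
      simpa [ha, hz, two] using this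
    subst hy
    have q0 : 5 * z ^ 2 + 3 * x ^ 2 = 0 := by
      have : a * (5 * z ^ 2 + 3 * x ^ 2) = 0 := by linear_combination -r0
      exact (mul_eq_zero.mp this).resolve_left ha
    have q2 : 10 * x + 3 * s * z = 0 := by
      have : a * (z * (10 * x + 3 * s * z)) = 0 := by linear_combination -r2
      exact (mul_eq_zero.mp ((mul_eq_zero.mp this).resolve_left ha)).resolve_left hz
    have : z ^ 2 = 0 := by
      -- 446 z ^ 2 = 0
      have : 446 * z ^ 2 = 0 := by
        linear_combination 100 * q0 - 3 * (10 * x - 3 * s * z) * q2 - 27 * z ^ 2 * hs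
      linear_combination 10 * this - 343 * z ^ 2 * h13
    exact hz (by simpa using this)
  have hw : w = 0 := r3.resolve_left hb
  subst hw
  obtain ⟨t, rfl⟩ : ∃ t, x = t * z := ⟨x / z, by field_simp⟩
  obtain ⟨u, rfl⟩ : ∃ u, y = u * z := ⟨y / z, by field_simp⟩
  have E : u ^ 2 = t ^ 3 + 5 * t + s := by
    have : z ^ 3 * (u ^ 2 - (t ^ 3 + 5 * t + s)) = 0 := by linear_combination hP
    exact sub_eq_zero.mp ((mul_eq_zero.mp this).resolve_left (pow_ne_zero _ hz))
  have F : t ^ 2 + α * t * u + 6 * s * t + (8 * s + 3) * u ^ 2 + 3 * α * s * u + (8 * s - 6) = 0 := by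
    have : z ^ 2 * (t ^ 2 + α * t * u + 6 * s * t + (8 * s + 3) * u ^ 2 + 3 * α * s * u +
      (8 * s - 6)) = 0 := by linear_combination -hQ
    exact (mul_eq_zero.mp this).resolve_left (pow_ne_zero _ hz)
  have J : (3 * t ^ 2 + 5) * (α * t + 2 * (8 * s + 3) * u + 3 * α * s) +
      2 * u * (2 * t + α * u + 6 * s) = 0 := by
    have : b * z ^ 3 * ((3 * t ^ 2 + 5) * (α * t + 2 * (8 * s + 3) * u + 3 * α * s) +
      2 * u * (2 * t + α * u + 6 * s)) = 0 := by
      linear_combination (-(3 * t ^ 2 + 5) * z ^ 2) * r1 - (2 * u * z ^ 2) * r0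
    exact (mul_eq_zero.mp this).resolve_left (mul_ne_zero hb (pow_ne_zero _ hz))
  obtain ⟨g, hg⟩ : ∃ g, g = t ^ 3 + 5 * t + s := ⟨_, rfl⟩
  obtain ⟨h, hh⟩ : ∃ h, h = (8 * s + 3) * g + t ^ 2 + 6 * s * t + (8 * s - 6) := ⟨_, rfl⟩
  have E' : u ^ 2 = g := by rw [hg, E]
  have L : α * (t + 3 * s) * u = -h := by
    rw [hh]; linear_combination F - (8 * s + 3) * E'
  refine bez s t hs h g hh hg ?_ ?_
  · rw [← hα, ← E']
    linear_combination (h - α * (t + 3 * s) * u) * L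
  · rw [← hα, ← E']
    linear_combination (-(α * (t + 3 * s))) * J +
      2 * ((8 * s + 3) * (3 * t ^ 2 + 5) + 2 * t + 6 * s) * L

/-- over the algebraic closure of `F_13`, there exist `s, α` with `s² = −2`
and `α² = 6s − 1` such that the curve `C = V(P,Q)` above is nonsingular and its Hasse–Witt
matrix vanishes; `C` is a superspecial genus-4 curve (a superspecial DCEC) in
characteristic 13. -/
theorem stmt14 :
    ∃ s α : K13, s ^ 2 = -2 ∧ α ^ 2 = 6 * s - 1 ∧
      (∀ v : Fin 4 → K13, v ≠ 0 → eval v (P13 s) = 0 → eval v (Q13 s α) = 0 →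
          ¬ (jacMat (P13 s) (Q13 s α) v).rank ≤ 1) ∧
      HasseWittVanishes 13 (P13 s) (Q13 s α) := by
  obtain ⟨s, hs⟩ := IsAlgClosed.exists_pow_nat_eq (-2 : K13) (n := 2) (by norm_num)
  obtain ⟨α, hα⟩ := IsAlgClosed.exists_pow_nat_eq (6 * s - 1 : K13) (n := 2) (by norm_num)
  exact ⟨s, α, hs, hα, nonsing s α hs hα, HW s α hs hα⟩


end
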